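/- arXiv:2410.00209 — 13 statements merged into one kernel-verified Lean document; each statement's English description precedes it below -/
import Mathlib

section
/- There exists a constant C > 0 such that for every string s of length n ≥ 2 over any alphabet, the number of pairs (i, j) with 1 ≤ i ≤ j ≤ n such that s[i..j] is a right closed repeat of s is at most C·n·log n, and likewise the number of pairs (i, j) such that s[i..j] is a left closed repeat of s is at most C·n·log n. -/
/-- The substring `s[i..j]` of a (1-indexed) string `s` occurs at position `k`,
i.e. `s[k..k+(j-i)] = s[i..j]`. -/
def OccursAt {α : Type*} (s : ℕ → α) (i j k : ℕ) : Prop :=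
  ∀ d : ℕ, d ≤ j - i → s (k + d) = s (i + d)

/-- `s[i'..i'+(j-i)]` is the next occurrence of the non-empty substring `s[i..j]`
of a string `s` of length `n`: it is an occurrence with `i' > i`, it fits in the
string, and `s[i..j]` does not occur at any of the positions `i+1, ..., i'-1`. -/
def IsNextOcc {α : Type*} (s : ℕ → α) (n i j i' : ℕ) : Prop :=
  1 ≤ i ∧ i ≤ j ∧ j ≤ n ∧ i < i' ∧ i' + (j - i) ≤ n ∧ OccursAt s i j i' ∧
    ∀ k, i < k → k < i' → ¬ OccursAt s i j k

/-- `s[i..j]` is a right closed repeat of `s` (of length `n`) whose next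
occurrence starts at position `i'`. -/
def IsRightClosedWith {α : Type*} (s : ℕ → α) (n i j i' : ℕ) : Prop :=
  IsNextOcc s n i j i' ∧ (i' + (j - i) = n ∨ s (j + 1) ≠ s (i' + (j - i) + 1))

/-- `s[i..j]` is a left closed repeat of `s` (of length `n`) whose next
occurrence starts at position `i'`. -/
def IsLeftClosedWith {α : Type*} (s : ℕ → α) (n i j i' : ℕ) : Prop :=
  IsNextOcc s n i j i' ∧ (i = 1 ∨ s (i - 1) ≠ s (i' - 1))

/-- `s[i..j]` is a closed repeat of `s` (of length `n`) whose next occurrence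
starts at position `i'`. -/
def IsClosedWith {α : Type*} (s : ℕ → α) (n i j i' : ℕ) : Prop :=
  IsRightClosedWith s n i j i' ∧ IsLeftClosedWith s n i j i'

/-- `s[i..j]` is a right closed repeat of `s` of length `n`. -/
def IsRightClosedRepeat {α : Type*} (s : ℕ → α) (n i j : ℕ) : Prop :=
  ∃ i', IsRightClosedWith s n i j i'

/-- `s[i..j]` is a left closed repeat of `s` of length `n`. -/
def IsLeftClosedRepeat {α : Type*} (s : ℕ → α) (n i j : ℕ) : Prop :=
  ∃ i', IsLeftClosedWith s n i j i'

/-- `s[i..j]` is a closed repeat of `s` of length `n`. -/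
def IsClosedRepeat {α : Type*} (s : ℕ → α) (n i j : ℕ) : Prop :=
  ∃ i', IsClosedWith s n i j i'

open Finset in
/-- Heavy-path counting: suppose that every `p ∈ S` yields two distinct points `x p`, `y p` of one
class at level `L p`, lying in disjoint classes at level `L p + 1`. At least one of the two then
loses half of its class, which happens at most `Nat.log 2 n` times to a given point. -/
theorem card_le_of_refining_classes {β : Type*} (S : Set β) (x y L : β → ℕ)
    (c : ℕ → ℕ → Finset ℕ) (n : ℕ) (hsub : ∀ a l, c a l ⊆ Icc 1 n)
    (hanti : ∀ a, Antitone (c a)) (hx : ∀ p ∈ S, x p ∈ c (x p) (L p))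
    (hy : ∀ p ∈ S, y p ∈ c (x p) (L p)) (hxy : ∀ p ∈ S, x p ≠ y p)
    (hc : ∀ p ∈ S, c (y p) (L p) = c (x p) (L p))
    (hdisj : ∀ p ∈ S, Disjoint (c (x p) (L p + 1)) (c (y p) (L p + 1)))
    (hxinj : ∀ p ∈ S, ∀ q ∈ S, x p = x q → L p = L q → p = q)
    (hyinj : ∀ p ∈ S, ∀ q ∈ S, y p = y q → L p = L q → p = q) :
    Nat.card S ≤ 2 * n * Nat.log 2 n := by
  classical
  have htwo : ∀ p ∈ S, 2 ≤ #(c (x p) (L p)) := fun p hp =>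
    Finset.one_lt_card.2 ⟨x p, hx p hp, y p, hy p hp, hxy p hp⟩
  have hhalf : ∀ p ∈ S, 2 * #(c (x p) (L p + 1)) ≤ #(c (x p) (L p)) ∨
      2 * #(c (y p) (L p + 1)) ≤ #(c (y p) (L p)) := by
    intro p hp
    have h1 := hanti (x p) (Nat.le_succ (L p))
    have h2 := hanti (y p) (Nat.le_succ (L p))
    rw [hc p hp] at h2 ⊢
    have h3 := card_le_card (union_subset h1 h2)
    rw [Nat.succ_eq_add_one, card_union_of_disjoint (hdisj p hp)] at h3
    omega
  have hlevel : ∀ a l l', 2 * #(c a (l + 1)) ≤ #(c a l) → 2 ≤ #(c a l') →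
      Nat.log 2 #(c a l) = Nat.log 2 #(c a l') → l' ≤ l := by
    intro a l l' h h2 hlog
    by_contra! hlt
    have h3 : #(c a l') * 2 ≤ #(c a l) := by
      have := card_le_card (hanti a (show l + 1 ≤ l' from hlt))
      omega
    have h4 := Nat.log_mono_right (b := 2) h3
    rw [Nat.log_mul_base one_lt_two (by omega)] at h4
    omega
  let g : β → Bool × ℕ × ℕ := fun p =>
    if 2 * #(c (x p) (L p + 1)) ≤ #(c (x p) (L p)) then
      (true, x p, Nat.log 2 #(c (x p) (L p)))
    else (false, y p, Nat.log 2 #(c (y p) (L p)))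
  let T : Finset (Bool × ℕ × ℕ) := univ ×ˢ Icc 1 n ×ˢ Icc 1 (Nat.log 2 n)
  have hmaps : ∀ p ∈ S, g p ∈ (T : Set (Bool × ℕ × ℕ)) := by
    intro p hp
    have h1 : 1 ≤ Nat.log 2 #(c (x p) (L p)) := Nat.log_pos one_lt_two (htwo p hp)
    have h2 : Nat.log 2 #(c (x p) (L p)) ≤ Nat.log 2 n :=
      Nat.log_mono_right (by simpa using card_le_card (hsub (x p) (L p)))
    have h3 := hsub _ _ (hx p hp)
    have h4 := hsub _ _ (hy p hp)
    simp only [Finset.mem_Icc] at h3 h4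
    simp only [g, T]
    split_ifs <;> simp [hc p hp] <;> omega
  have hinj : Set.InjOn g S := by
    intro p hp q hq hpq
    simp only [g] at hpq
    have h2p := htwo p hp
    have h2q := htwo q hq
    split_ifs at hpq with h1 h2 h2
    · simp only [Prod.mk.injEq, true_and] at hpq
      obtain ⟨h3, h4⟩ := hpq
      rw [← h3] at h2 h4 h2q
      exact hxinj p hp q hq h3
        (le_antisymm (hlevel _ _ _ h2 h2p h4.symm) (hlevel _ _ _ h1 h2q h4))
    · simp at hpq
    · simp at hpq
    · simp only [Prod.mk.injEq, true_and] at hpq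
      obtain ⟨h3, h4⟩ := hpq
      replace h1 := (hhalf p hp).resolve_left h1
      replace h2 := (hhalf q hq).resolve_left h2
      rw [← hc p hp] at h2p
      rw [← hc q hq, ← h3] at h2q
      rw [← h3] at h2 h4
      exact hyinj p hp q hq h3
        (le_antisymm (hlevel _ _ _ h2 h2p h4.symm) (hlevel _ _ _ h1 h2q h4))
  calc Nat.card S = S.ncard := Nat.card_coe_set_eq S
    _ ≤ (T : Set (Bool × ℕ × ℕ)).ncard :=
      Set.ncard_le_ncard_of_injOn g hmaps hinj T.finite_toSet
    _ = 2 * n * Nat.log 2 n := by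
      rw [Set.ncard_coe_finset]
      simp [T, mul_assoc]

theorem IsNextOcc.start_le {α : Type*} {s : ℕ → α} {n i j i' j' k : ℕ}
    (h : IsNextOcc s n i j k) (h' : IsNextOcc s n i' j' k) (hl : j - i = j' - i') : i' ≤ i := by
  obtain ⟨_, _, _, _, _, ho, hno⟩ := h
  obtain ⟨_, _, _, hk, _, ho', _⟩ := h'
  by_contra! hlt
  exact hno i' hlt hk fun d hd => (ho' d (hl ▸ hd)).symm.trans (ho d hd)

/-- A substring is determined by its length and its next occurrence. -/
theorem IsNextOcc.eq_of_length_eq {α : Type*} {s : ℕ → α} {n i j i' j' k : ℕ}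
    (h : IsNextOcc s n i j k) (h' : IsNextOcc s n i' j' k) (hl : j - i = j' - i') :
    i = i' ∧ j = j' := by
  have h1 := h.start_le h' hl
  have h2 := h'.start_le h hl.symm
  have h3 := h.2.1
  have h4 := h'.2.1
  omega

open Classical in
theorem card_isRightClosedRepeat_le {α : Type*} (s : ℕ → α) (n : ℕ) :
    Nat.card {p : ℕ × ℕ // IsRightClosedRepeat s n p.1 p.2} ≤ 2 * n * Nat.log 2 n := by
  choose! k hk using
    show ∀ p : ℕ × ℕ, IsRightClosedRepeat s n p.1 p.2 → ∃ k, IsRightClosedWith s n p.1 p.2 k from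
      fun _ h => h
  refine card_le_of_refining_classes {p : ℕ × ℕ | IsRightClosedRepeat s n p.1 p.2}
    (fun p => p.1) k (fun p => p.2 - p.1 + 1)
    (fun a l => {b ∈ Finset.Icc 1 n |
      b + l ≤ n + 1 ∧ a + l ≤ n + 1 ∧ ∀ d < l, s (b + d) = s (a + d)})
    n (fun a l => Finset.filter_subset _ _) ?_ ?_ ?_ ?_ ?_ ?_ ?_ ?_
  · intro a l l' hl b hb
    simp only [Finset.mem_filter] at hb ⊢
    exact ⟨hb.1, by omega, by omega, fun d hd => hb.2.2.2 d (by omega)⟩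
  · intro p hp
    obtain ⟨⟨_, _, _, _, _, _, _⟩, _⟩ := hk p hp
    simp only [Finset.mem_filter, Finset.mem_Icc]
    exact ⟨by omega, by omega, by omega, by simp⟩
  · intro p hp
    obtain ⟨⟨_, _, _, _, _, ho, _⟩, _⟩ := hk p hp
    simp only [Finset.mem_filter, Finset.mem_Icc]
    exact ⟨by omega, by omega, by omega, fun d hd => ho d (by omega)⟩
  · intro p hp
    exact (hk p hp).1.2.2.2.1.ne
  · intro p hp
    obtain ⟨⟨_, _, _, _, _, ho, _⟩, _⟩ := hk p hp
    ext b
    simp only [Finset.mem_filter]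
    refine and_congr_right fun _ => and_congr_right fun _ =>
      and_congr (by omega) (forall₂_congr fun d hd => ?_)
    rw [ho d (by omega)]
  · intro p hp
    obtain ⟨⟨_, _, _, _, _, _, _⟩, hr⟩ := hk p hp
    rw [Finset.disjoint_left]
    intro b hb hb'
    simp only [Finset.mem_filter] at hb hb'
    refine hr.elim (by omega) fun hne => hne ?_
    have h := (hb.2.2.2 (p.2 - p.1 + 1) (by omega)).symm.trans
      (hb'.2.2.2 (p.2 - p.1 + 1) (by omega))
    rwa [show p.1 + (p.2 - p.1 + 1) = p.2 + 1 by omega, ← add_assoc] at h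
  · intro p hp q hq hpq hl
    have h1 := (hk p hp).1.2.1
    have h2 := (hk q hq).1.2.1
    exact Prod.ext hpq (by omega)
  · intro p hp q hq hpq hl
    have h := (hk p hp).1.eq_of_length_eq (hpq ▸ (hk q hq).1) (by omega)
    exact Prod.ext h.1 h.2

open Classical in
theorem card_isLeftClosedRepeat_le {α : Type*} (s : ℕ → α) (n : ℕ) :
    Nat.card {p : ℕ × ℕ // IsLeftClosedRepeat s n p.1 p.2} ≤ 2 * n * Nat.log 2 n := by
  choose! k hk using
    show ∀ p : ℕ × ℕ, IsLeftClosedRepeat s n p.1 p.2 → ∃ k, IsLeftClosedWith s n p.1 p.2 k from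
      fun _ h => h
  refine card_le_of_refining_classes {p : ℕ × ℕ | IsLeftClosedRepeat s n p.1 p.2}
    (fun p => p.2) (fun p => k p + (p.2 - p.1)) (fun p => p.2 - p.1 + 1)
    (fun a l => {b ∈ Finset.Icc 1 n | l ≤ b ∧ l ≤ a ∧ ∀ d < l, s (b - d) = s (a - d)})
    n (fun a l => Finset.filter_subset _ _) ?_ ?_ ?_ ?_ ?_ ?_ ?_ ?_
  · intro a l l' hl b hb
    simp only [Finset.mem_filter] at hb ⊢
    exact ⟨hb.1, by omega, by omega, fun d hd => hb.2.2.2 d (by omega)⟩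
  · intro p hp
    obtain ⟨⟨_, _, _, _, _, _, _⟩, _⟩ := hk p hp
    simp only [Finset.mem_filter, Finset.mem_Icc]
    exact ⟨by omega, by omega, by omega, by simp⟩
  · intro p hp
    obtain ⟨⟨_, _, _, _, _, ho, _⟩, _⟩ := hk p hp
    simp only [Finset.mem_filter, Finset.mem_Icc]
    refine ⟨by omega, by omega, by omega, fun d hd => ?_⟩
    have h := ho (p.2 - p.1 - d) (by omega)
    rwa [show k p + (p.2 - p.1 - d) = k p + (p.2 - p.1) - d by omega,
      show p.1 + (p.2 - p.1 - d) = p.2 - d by omega] at h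
  · intro p hp
    obtain ⟨⟨_, _, _, _, _, _, _⟩, _⟩ := hk p hp
    omega
  · intro p hp
    obtain ⟨⟨_, _, _, _, _, ho, _⟩, _⟩ := hk p hp
    ext b
    simp only [Finset.mem_filter]
    refine and_congr_right fun _ => and_congr_right fun _ =>
      and_congr (by omega) (forall₂_congr fun d hd => ?_)
    have h := ho (p.2 - p.1 - d) (by omega)
    rw [show k p + (p.2 - p.1 - d) = k p + (p.2 - p.1) - d by omega,
      show p.1 + (p.2 - p.1 - d) = p.2 - d by omega] at h
    rw [h]
  · intro p hp
    obtain ⟨⟨_, _, _, _, _, _, _⟩, hr⟩ := hk p hp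
    rw [Finset.disjoint_left]
    intro b hb hb'
    simp only [Finset.mem_filter] at hb hb'
    refine hr.elim (by omega) fun hne => hne ?_
    have h := (hb.2.2.2 (p.2 - p.1 + 1) (by omega)).symm.trans
      (hb'.2.2.2 (p.2 - p.1 + 1) (by omega))
    rwa [show p.2 - (p.2 - p.1 + 1) = p.1 - 1 by omega,
      show k p + (p.2 - p.1) - (p.2 - p.1 + 1) = k p - 1 by omega] at h
  · intro p hp q hq hpq hl
    have h1 := (hk p hp).1.2.1
    have h2 := (hk q hq).1.2.1
    exact Prod.ext (by omega) hpq
  · intro p hp q hq hpq hl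
    have h := (hk p hp).1.eq_of_length_eq
      ((show k q = k p by omega) ▸ (hk q hq).1) (by omega)
    exact Prod.ext h.1 h.2

/-- There is a constant `C > 0` such that any string of length `n ≥ 2`, over any
alphabet, has at most `C·n·log n` right closed repeats and at most `C·n·log n`
left closed repeats. -/
theorem statement0 :
    ∃ C : ℝ, 0 < C ∧ ∀ (n : ℕ), 2 ≤ n → ∀ (α : Type*) (s : ℕ → α),
      (Nat.card {p : ℕ × ℕ // IsRightClosedRepeat s n p.1 p.2} : ℝ) ≤ C * n * Real.log n ∧
      (Nat.card {p : ℕ × ℕ // IsLeftClosedRepeat s n p.1 p.2} : ℝ) ≤ C * n * Real.log n := by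
  have hlog : (0 : ℝ) < Real.log 2 := Real.log_pos one_lt_two
  refine ⟨2 / Real.log 2, by positivity, fun n _ α s => ?_⟩
  have hbound : ∀ m : ℕ, m ≤ 2 * n * Nat.log 2 n →
      (m : ℝ) ≤ 2 / Real.log 2 * n * Real.log n := by
    intro m hm
    calc (m : ℝ) ≤ 2 * n * Nat.log 2 n := by exact_mod_cast hm
      _ ≤ 2 * n * Real.logb 2 n := by
        gcongr
        exact_mod_cast Real.natLog_le_logb n 2
      _ = 2 / Real.log 2 * n * Real.log n := by
        rw [Real.logb]
        ring
  exact ⟨hbound _ (card_isRightClosedRepeat_le s n), hbound _ (card_isLeftClosedRepeat_le s n)⟩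
end

section
/- There exist constants c > 0 and N such that for every n ≥ N, if s is a uniformly random binary string of length n, then the expected number of pairs (i, j) with 1 ≤ i ≤ j ≤ n such that s[i..j] is a closed repeat of s is at least c·n·log n. -/
/-- Interpret a binary word `v : Fin n → Bool` as a 1-indexed string `ℕ → Bool`
(positions outside `[1..n]` are irrelevant for the predicates below). -/
def ext (n : ℕ) (v : Fin n → Bool) : ℕ → Bool :=
  fun k => if h : k - 1 < n then v ⟨k - 1, h⟩ else false

open Finset in
/-- Words of length `d + 1` have at most `2 ^ (d + 1)` last occurrences; every other occurrence
has a next one. -/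
theorem card_filter_exists_isNextOcc (s : ℕ → Bool) (n d : ℕ) [DecidablePred fun i : ℕ =>
    ∃ i', IsNextOcc s n i (i + d) i'] :
    n - d - 2 ^ (d + 1) ≤
      #{i ∈ Icc 1 (n - d) | ∃ i', IsNextOcc s n i (i + d) i'} := by
  classical
  have hlast : #{i ∈ Icc 1 (n - d) | ¬ ∃ i', IsNextOcc s n i (i + d) i'} ≤ 2 ^ (d + 1) := by
    have hcard : #(univ : Finset (Fin (d + 1) → Bool)) = 2 ^ (d + 1) := by simp
    rw [← hcard]
    refine card_le_card_of_injOn (fun i x => s (i + x)) (fun _ _ => mem_coe.2 (mem_univ _)) ?_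
    have key : ∀ a b : ℕ, 1 ≤ a → a < b → b ≤ n - d →
        (∀ x : Fin (d + 1), s (a + x) = s (b + x)) → ∃ i', IsNextOcc s n a (a + d) i' := by
      intro a b ha hab hb hw
      have hex : ∃ k, a < k ∧ OccursAt s a (a + d) k :=
        ⟨b, hab, fun e he => (hw ⟨e, by omega⟩).symm⟩
      have hmin : Nat.find hex ≤ b :=
        Nat.find_min' hex ⟨hab, fun e he => (hw ⟨e, by omega⟩).symm⟩
      refine ⟨Nat.find hex, ha, by omega, by omega, (Nat.find_spec hex).1, by omega,
        (Nat.find_spec hex).2, fun k hk hk' ho => Nat.find_min hex hk' ⟨hk, ho⟩⟩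
    intro a ha b hb hw
    simp only [coe_filter, mem_Icc, Set.mem_ofPred_eq] at ha hb
    have hw' : ∀ x : Fin (d + 1), s (a + x) = s (b + x) := fun x => congrFun hw x
    rcases lt_trichotomy a b with h | h | h
    · exact absurd (key a b ha.1.1 h hb.1.2 hw') ha.2
    · exact h
    · exact absurd (key b a hb.1.1 h ha.1.2 fun x => (hw' x).symm) hb.2
  have hsum := card_filter_add_card_filter_not (s := Icc 1 (n - d))
    (fun i => ∃ i', IsNextOcc s n i (i + d) i')
  rw [Nat.card_Icc] at hsum
  omega

/-- Flip the letter of `v` at the (1-indexed) position `k`. -/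
def flipAt {n : ℕ} (k : ℕ) (v : Fin n → Bool) : Fin n → Bool :=
  fun x => if x.val + 1 = k then !v x else v x

theorem flipAt_flipAt {n : ℕ} (k : ℕ) (v : Fin n → Bool) : flipAt k (flipAt k v) = v := by
  funext x
  by_cases h : x.val + 1 = k <;> simp [flipAt, h]

theorem ext_flipAt_of_ne {n k p : ℕ} (v : Fin n → Bool) (hp : 1 ≤ p) (h : p ≠ k) :
    ext n (flipAt k v) p = ext n v p := by
  have : p - 1 + 1 ≠ k := by omega
  simp [ext, flipAt, this]

theorem ext_flipAt_self {n k : ℕ} (v : Fin n → Bool) (hk : 1 ≤ k) (hn : k ≤ n) :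
    ext n (flipAt k v) k = !ext n v k := by
  have h₁ : k - 1 + 1 = k := by omega
  have h₂ : k - 1 < n := by omega
  simp [ext, flipAt, h₁, h₂]

theorem IsNextOcc.congr {α : Type*} {s t : ℕ → α} {n i j i' : ℕ} (h : IsNextOcc s n i j i')
    (hst : ∀ p, i ≤ p → p ≤ i' + (j - i) → t p = s p) : IsNextOcc t n i j i' := by
  obtain ⟨h1, h2, h3, h4, h5, h6, h7⟩ := h
  refine ⟨h1, h2, h3, h4, h5, fun d hd => ?_, fun k hk hk' ho => h7 k hk hk' fun d hd => ?_⟩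
  · rw [hst _ (by omega) (by omega), hst _ (by omega) (by omega), h6 d hd]
  · rw [← hst _ (by omega) (by omega), ← hst _ (by omega) (by omega), ho d hd]

theorem IsNextOcc.unique {α : Type*} {s : ℕ → α} {n i j a b : ℕ} (ha : IsNextOcc s n i j a)
    (hb : IsNextOcc s n i j b) : a = b := by
  obtain ⟨-, -, -, ha₁, -, ha₂, ha₃⟩ := ha
  obtain ⟨-, -, -, hb₁, -, hb₂, hb₃⟩ := hb
  rcases lt_trichotomy a b with h | h | h
  · exact absurd ha₂ (hb₃ a ha₁ h)
  · exact h
  · exact absurd hb₂ (ha₃ b hb₁ h)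

/-- Flipping the letter before the first occurrence toggles only the left condition. -/
theorem IsNextOcc.exists_isLeftClosedWith {n i j i' : ℕ} {v : Fin n → Bool}
    (h : IsNextOcc (ext n v) n i j i') :
    IsLeftClosedWith (ext n v) n i j i' ∨
      IsLeftClosedWith (ext n (flipAt (i - 1) v)) n i j i' := by
  by_cases hl : i = 1 ∨ ext n v (i - 1) ≠ ext n v (i' - 1)
  · exact Or.inl ⟨h, hl⟩
  · push Not at hl
    have ⟨h1, h2, h3, h4, h5, _⟩ := h
    refine Or.inr ⟨h.congr fun p hp _ => ext_flipAt_of_ne v (by omega) (by omega), Or.inr ?_⟩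
    rw [ext_flipAt_self v (by omega) (by omega), ext_flipAt_of_ne v (by omega) (by omega), hl.2]
    simp

/-- Flipping the letter after the next occurrence toggles only the right condition. -/
theorem IsLeftClosedWith.exists_isClosedWith {n i j i' : ℕ} {v : Fin n → Bool}
    (h : IsLeftClosedWith (ext n v) n i j i') :
    IsClosedWith (ext n v) n i j i' ∨
      IsClosedWith (ext n (flipAt (i' + (j - i) + 1) v)) n i j i' := by
  obtain ⟨h, hl⟩ := h
  by_cases hr : i' + (j - i) = n ∨ ext n v (j + 1) ≠ ext n v (i' + (j - i) + 1)
  · exact Or.inl ⟨⟨h, hr⟩, h, hl⟩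
  · push Not at hr
    have ⟨h1, h2, h3, h4, h5, _⟩ := h
    have h' : IsNextOcc (ext n (flipAt (i' + (j - i) + 1) v)) n i j i' :=
      h.congr fun p hp _ => ext_flipAt_of_ne v (by omega) (by omega)
    refine Or.inr ⟨⟨h', Or.inr ?_⟩, h', ?_⟩
    · rw [ext_flipAt_self v (by omega) (by omega), ext_flipAt_of_ne v (by omega) (by omega), hr.2]
      simp
    · rcases eq_or_ne i 1 with hi | hi
      · exact Or.inl hi
      · rw [ext_flipAt_of_ne v (by omega) (by omega), ext_flipAt_of_ne v (by omega) (by omega)]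
        exact hl

open Finset Classical in
theorem card_isNextOcc_le (n i j i' : ℕ) :
    #{v : Fin n → Bool | IsNextOcc (ext n v) n i j i'} ≤
      4 * #{v : Fin n → Bool | IsClosedWith (ext n v) n i j i'} := by
  have hunion : ∀ (P Q : (Fin n → Bool) → Prop) (k : ℕ),
      (∀ v, P v → Q v ∨ Q (flipAt k v)) → #{v | P v} ≤ 2 * #{v | Q v} := by
    intro P Q k hPQ
    calc #{v | P v} ≤ #(({v | Q v} : Finset (Fin n → Bool)) ∪
          ({v | Q v} : Finset (Fin n → Bool)).image (flipAt k)) := by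
          refine card_le_card fun v hv => ?_
          rcases hPQ v (mem_filter.1 hv).2 with h | h
          · exact mem_union_left _ (by simpa using h)
          · exact mem_union_right _ (mem_image.2 ⟨_, by simpa using h, flipAt_flipAt k v⟩)
      _ ≤ #{v | Q v} + #(({v | Q v} : Finset (Fin n → Bool)).image (flipAt k)) :=
          card_union_le _ _
      _ ≤ #{v | Q v} + #{v | Q v} := Nat.add_le_add_left card_image_le _
      _ = 2 * #{v | Q v} := (two_mul _).symm
  have h₁ := hunion _ _ _ fun v (h : IsNextOcc (ext n v) n i j i') => h.exists_isLeftClosedWith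
  have h₂ := hunion _ _ _ fun v (h : IsLeftClosedWith (ext n v) n i j i') => h.exists_isClosedWith
  omega

open Finset Classical in
theorem card_isClosedWith_le {α : Type*} (s : ℕ → α) (n : ℕ) (T : Finset (ℕ × ℕ × ℕ)) :
    #{t ∈ T | IsClosedWith s n t.1 t.2.1 t.2.2} ≤
      Nat.card {p : ℕ × ℕ // IsClosedRepeat s n p.1 p.2} := by
  have hfin : {p : ℕ × ℕ | IsClosedRepeat s n p.1 p.2}.Finite := by
    refine ((range (n + 1)) ×ˢ (range (n + 1))).finite_toSet.subset ?_
    rintro ⟨i, j⟩ ⟨i', ⟨⟨h1, h2, h3, -⟩, -⟩, -⟩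
    simp only [coe_product, coe_range, Set.mem_prod, Set.mem_Iio]
    omega
  have hinj : Set.InjOn (fun t : ℕ × ℕ × ℕ => (t.1, t.2.1))
      {t ∈ T | IsClosedWith s n t.1 t.2.1 t.2.2} := by
    rintro ⟨i, j, a⟩ ha ⟨i₂, j₂, b⟩ hb hab
    obtain ⟨rfl, rfl⟩ : i = i₂ ∧ j = j₂ := by simpa using hab
    have ha' : IsNextOcc s n i j a := ha.2.1.1
    have hb' : IsNextOcc s n i j b := hb.2.1.1
    rw [ha'.unique hb']
  have himage : #{t ∈ T | IsClosedWith s n t.1 t.2.1 t.2.2} =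
      #({t ∈ T | IsClosedWith s n t.1 t.2.1 t.2.2}.image fun t => (t.1, t.2.1)) :=
    (card_image_of_injOn (by simpa using hinj)).symm
  rw [himage, ← Set.ncard_coe_finset]
  refine Set.ncard_le_ncard ?_ hfin
  intro p hp
  obtain ⟨t, ht, rfl⟩ := mem_image.1 (mem_coe.1 hp)
  exact ⟨t.2.2, (mem_filter.1 ht).2⟩

open Finset Classical in
theorem sum_le_card_isNextOcc (s : ℕ → Bool) (n K : ℕ) :
    ∑ d ∈ range K, (n - d - 2 ^ (d + 1)) ≤
      #{t ∈ range (n + 1) ×ˢ range (n + 1) ×ˢ range (n + 1) |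
        IsNextOcc s n t.1 t.2.1 t.2.2} := by
  calc ∑ d ∈ range K, (n - d - 2 ^ (d + 1))
      ≤ ∑ d ∈ range K, #{i ∈ Icc 1 (n - d) | ∃ i', IsNextOcc s n i (i + d) i'} :=
        sum_le_sum fun d _ => card_filter_exists_isNextOcc s n d
    _ = #((range K).sigma fun d => {i ∈ Icc 1 (n - d) | ∃ i', IsNextOcc s n i (i + d) i'}) :=
        (card_sigma _ _).symm
    _ ≤ _ := by
        refine card_le_card_of_surjOn (fun t => ⟨t.2.1 - t.1, t.1⟩) ?_
        rintro ⟨d, i⟩ h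
        simp only [coe_sigma, Set.mem_sigma_iff, mem_coe, mem_filter, mem_range, mem_Icc] at h
        obtain ⟨hd, hi, i', h'⟩ := h
        have ⟨h1, h2, h3, h4, h5, _⟩ := h'
        refine ⟨(i, i + d, i'), ?_, by simp⟩
        simp only [coe_filter, mem_product, mem_range, Set.mem_ofPred_eq]
        exact ⟨⟨by omega, by omega, by omega⟩, h'⟩

theorem quarter_mul_le_sum (n : ℕ) :
    (Nat.log 2 n - 1) * n ≤ 4 * ∑ d ∈ Finset.range (Nat.log 2 n - 1), (n - d - 2 ^ (d + 1)) := by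
  rw [Finset.mul_sum, ← smul_eq_mul, ← Finset.card_range (Nat.log 2 n - 1),
    ← Finset.sum_const, Finset.card_range]
  refine Finset.sum_le_sum fun d hd => ?_
  have hd' : d + 2 ≤ Nat.log 2 n := by have := Finset.mem_range.1 hd; omega
  have h₁ : 2 ^ (d + 2) ≤ n :=
    (Nat.pow_le_pow_right two_pos hd').trans
      (Nat.pow_log_le_self 2 (by rintro rfl; simp at hd'))
  have h₂ : d < 2 ^ d := Nat.lt_two_pow_self
  rw [pow_add] at h₁ ⊢
  omega

open Finset in
theorem sum_card_isClosedRepeat_ge (n : ℕ) :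
    (Nat.log 2 n - 1) * n * 2 ^ n ≤
      16 * ∑ v : Fin n → Bool, Nat.card {p : ℕ × ℕ // IsClosedRepeat (ext n v) n p.1 p.2} := by
  classical
  set T := range (n + 1) ×ˢ range (n + 1) ×ˢ range (n + 1)
  have hnext : (Nat.log 2 n - 1) * n * 2 ^ n ≤
      4 * ∑ v : Fin n → Bool, #{t ∈ T | IsNextOcc (ext n v) n t.1 t.2.1 t.2.2} := by
    have hconst : (Nat.log 2 n - 1) * n * 2 ^ n =
        ∑ _v : Fin n → Bool, (Nat.log 2 n - 1) * n := by simp [mul_comm]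
    rw [hconst, mul_sum]
    refine sum_le_sum fun v _ => (quarter_mul_le_sum n).trans ?_
    gcongr
    exact sum_le_card_isNextOcc (ext n v) n _
  have hswap : ∑ v : Fin n → Bool, #{t ∈ T | IsNextOcc (ext n v) n t.1 t.2.1 t.2.2} ≤
      4 * ∑ v : Fin n → Bool, #{t ∈ T | IsClosedWith (ext n v) n t.1 t.2.1 t.2.2} := by
    have h₁ := sum_card_bipartiteAbove_eq_sum_card_bipartiteBelow (s := univ) (t := T)
      fun (v : Fin n → Bool) t => IsNextOcc (ext n v) n t.1 t.2.1 t.2.2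
    have h₂ := sum_card_bipartiteAbove_eq_sum_card_bipartiteBelow (s := univ) (t := T)
      fun (v : Fin n → Bool) t => IsClosedWith (ext n v) n t.1 t.2.1 t.2.2
    simp only [bipartiteAbove, bipartiteBelow] at h₁ h₂
    rw [h₁, h₂, mul_sum]
    exact sum_le_sum fun t _ => by convert card_isNextOcc_le n t.1 t.2.1 t.2.2
  have hclosed : ∑ v : Fin n → Bool, #{t ∈ T | IsClosedWith (ext n v) n t.1 t.2.1 t.2.2} ≤
      ∑ v : Fin n → Bool, Nat.card {p : ℕ × ℕ // IsClosedRepeat (ext n v) n p.1 p.2} :=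
    sum_le_sum fun v _ => by convert card_isClosedWith_le (ext n v) n T
  omega

theorem log_le_two_mul_log_sub_one {n : ℕ} (hn : 8 ≤ n) :
    Real.log n ≤ 2 * ((Nat.log 2 n - 1 : ℕ) : ℝ) := by
  have hL : 3 ≤ Nat.log 2 n := Nat.le_log_of_pow_le one_lt_two (by simpa using hn)
  have hlt : (n : ℝ) ≤ 2 ^ (Nat.log 2 n + 1) := by
    exact_mod_cast (Nat.lt_pow_succ_log_self one_lt_two n).le
  have hlog := Real.log_le_log (by positivity) hlt
  rw [Real.log_pow] at hlog
  have h2 : Real.log 2 ≤ 1 := by linarith [Real.log_two_lt_d9]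
  have hle : ((Nat.log 2 n + 1 : ℕ) : ℝ) ≤ 2 * ((Nat.log 2 n - 1 : ℕ) : ℝ) := by
    exact_mod_cast (by omega : Nat.log 2 n + 1 ≤ 2 * (Nat.log 2 n - 1))
  calc Real.log n ≤ ((Nat.log 2 n + 1 : ℕ) : ℝ) * Real.log 2 := hlog
    _ ≤ ((Nat.log 2 n + 1 : ℕ) : ℝ) := mul_le_of_le_one_right (by positivity) h2
    _ ≤ _ := hle

/-- There are constants `c > 0` and `N` such that for `n ≥ N`, the expected
number of closed repeats of a uniformly random binary string of length `n`
is at least `c·n·log n`. -/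
theorem statement1 :
    ∃ c : ℝ, 0 < c ∧ ∃ N : ℕ, ∀ n : ℕ, N ≤ n →
      c * n * Real.log n ≤
        (∑ v : Fin n → Bool,
            (Nat.card {p : ℕ × ℕ // IsClosedRepeat (ext n v) n p.1 p.2} : ℝ)) / 2 ^ n := by
  refine ⟨1 / 32, by norm_num, 8, fun n hn => ?_⟩
  have hlog := log_le_two_mul_log_sub_one hn
  have hsum : ((Nat.log 2 n - 1 : ℕ) : ℝ) * n * 2 ^ n ≤ 16 * ∑ v : Fin n → Bool,
      (Nat.card {p : ℕ × ℕ // IsClosedRepeat (ext n v) n p.1 p.2} : ℝ) := by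
    exact_mod_cast sum_card_isClosedRepeat_ge n
  rw [le_div_iff₀ (by positivity)]
  have hmul : (n : ℝ) * 2 ^ n * Real.log n ≤
      n * 2 ^ n * (2 * ((Nat.log 2 n - 1 : ℕ) : ℝ)) := by gcongr
  linarith
end

section
/- Let n, i, b, j be integers with b ≥ 1, 2 ≤ i < j and j + b ≤ n, and let s be a uniformly random binary string of length n. Let E be the event that s[i..i+b-1] occurs at position j (i.e., s[j..j+b-1] = s[i..i+b-1]) but does not occur at any of the positions i+1, ..., j-1. If Pr(E) > 0, then the conditional probability, given E, that both s[i-1] ≠ s[j-1] and s[i+b] ≠ s[j+b] equals 1/4. -/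
/-- If an involution `f` preserves `P` and negates `Q`, then exactly half of the elements
satisfying `P` satisfy `Q`. -/
theorem two_mul_natCard_and_of_involutive {α : Type*} [Finite α] {f : α → α}
    (hf : Function.Involutive f) {P Q : α → Prop} (hP : ∀ v, P v → P (f v))
    (hQ : ∀ v, Q (f v) ↔ ¬ Q v) :
    2 * Nat.card {v : α // P v ∧ Q v} = Nat.card {v : α // P v} := by
  classical
  have := Fintype.ofFinite α
  have hcard : Fintype.card {v : α // P v ∧ Q v} = Fintype.card {v : α // P v ∧ ¬ Q v} :=
    Fintype.card_congr
      { toFun := fun v => ⟨f v, hP _ v.2.1, fun h => (hQ _).1 h v.2.2⟩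
        invFun := fun v => ⟨f v, hP _ v.2.1, (hQ _).2 v.2.2⟩
        left_inv := fun v => Subtype.ext (hf v)
        right_inv := fun v => Subtype.ext (hf v) }
  simp only [Nat.card_eq_fintype_card, Fintype.card_subtype, ← Finset.filter_filter] at hcard ⊢
  rw [two_mul, ← Finset.card_filter_add_card_filter_not (s := Finset.univ.filter P) Q]
  simp only [Finset.filter_filter] at hcard ⊢
  rw [← hcard]

/-- Flip the letter at the (0-indexed) position `p` of a binary word. -/
def flipLetter {n : ℕ} (p : Fin n) (v : Fin n → Bool) : Fin n → Bool :=
  Function.update v p (!v p)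

theorem flipLetter_involutive {n : ℕ} (p : Fin n) : Function.Involutive (flipLetter p) := by
  intro v
  simp [flipLetter]

theorem ext_flipLetter_self {n : ℕ} (p : Fin n) (v : Fin n → Bool) :
    ext n (flipLetter p v) (p + 1) = !ext n v (p + 1) := by
  simp [ext, flipLetter]

theorem ext_flipLetter_of_ne {n : ℕ} (p : Fin n) (v : Fin n → Bool) {k : ℕ}
    (hk : k - 1 ≠ p) : ext n (flipLetter p v) k = ext n v k := by
  by_cases h : k - 1 < n
  · have : (⟨k - 1, h⟩ : Fin n) ≠ p := fun e => hk (congrArg Fin.val e)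
    simp [ext, flipLetter, h, this]
  · simp [ext, h]

/-- The event that `s[i..i+b-1]` next occurs at position `j` depends only on the letters
`s[i..j+b-1]`. -/
theorem nextOccurrence_of_eqOn {α : Type*} {s t : ℕ → α} {i b j : ℕ} (hb : 1 ≤ b)
    (hij : i < j) (hst : ∀ k, i ≤ k → k < j + b → t k = s k)
    (h : OccursAt s i (i + b - 1) j ∧ ∀ k, i < k → k < j → ¬ OccursAt s i (i + b - 1) k) :
    OccursAt t i (i + b - 1) j ∧ ∀ k, i < k → k < j → ¬ OccursAt t i (i + b - 1) k := by
  have key : ∀ k, i ≤ k → k ≤ j →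
      (OccursAt t i (i + b - 1) k ↔ OccursAt s i (i + b - 1) k) := by
    intro k hik hkj
    refine forall₂_congr fun d hd => ?_
    rw [hst (k + d) (by omega) (by omega), hst (i + d) (by omega) (by omega)]
  exact ⟨(key j hij.le le_rfl).2 h.1,
    fun k hik hkj hk => h.2 k hik hkj ((key k hik.le hkj.le).1 hk)⟩

/-- Let `E` be the event that `s[i..i+b-1]` occurs at position `j` but at none of
the positions `i+1, ..., j-1`, for a uniformly random binary string `s` of
length `n`. If `Pr(E) > 0`, then the conditional probability, given `E`, that
`s[i-1] ≠ s[j-1]` and `s[i+b] ≠ s[j+b]` equals `1/4`. -/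
theorem statement4 (n i b j : ℕ) (hb : 1 ≤ b) (hi : 2 ≤ i) (hij : i < j)
    (hjb : j + b ≤ n)
    (hE : 0 < Nat.card {v : Fin n → Bool //
        OccursAt (ext n v) i (i + b - 1) j ∧
          ∀ k, i < k → k < j → ¬ OccursAt (ext n v) i (i + b - 1) k}) :
    (Nat.card {v : Fin n → Bool //
        (OccursAt (ext n v) i (i + b - 1) j ∧
          ∀ k, i < k → k < j → ¬ OccursAt (ext n v) i (i + b - 1) k) ∧
        ext n v (i - 1) ≠ ext n v (j - 1) ∧ ext n v (i + b) ≠ ext n v (j + b)} : ℝ) /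
      (Nat.card {v : Fin n → Bool //
        OccursAt (ext n v) i (i + b - 1) j ∧
          ∀ k, i < k → k < j → ¬ OccursAt (ext n v) i (i + b - 1) k} : ℝ) =
      1 / 4 := by
  obtain ⟨p, hp⟩ : ∃ p : Fin n, (p : ℕ) + 1 = i - 1 := ⟨⟨i - 2, by omega⟩, by simp; omega⟩
  obtain ⟨q, hq⟩ : ∃ q : Fin n, (q : ℕ) + 1 = j + b := ⟨⟨j + b - 1, by omega⟩, by simp; omega⟩
  have hleft := two_mul_natCard_and_of_involutive (flipLetter_involutive p)
    (P := fun v => OccursAt (ext n v) i (i + b - 1) j ∧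
      ∀ k, i < k → k < j → ¬ OccursAt (ext n v) i (i + b - 1) k)
    (Q := fun v => ext n v (i - 1) ≠ ext n v (j - 1))
    (fun v => nextOccurrence_of_eqOn hb hij fun k _ _ => ext_flipLetter_of_ne p v (by omega))
    (fun v => by
      rw [ext_flipLetter_of_ne p v (k := j - 1) (by omega), ← hp, ext_flipLetter_self]
      simp [Bool.not_eq_eq_eq_not])
  have hright := two_mul_natCard_and_of_involutive (flipLetter_involutive q)
    (P := fun v => (OccursAt (ext n v) i (i + b - 1) j ∧
      ∀ k, i < k → k < j → ¬ OccursAt (ext n v) i (i + b - 1) k) ∧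
        ext n v (i - 1) ≠ ext n v (j - 1))
    (Q := fun v => ext n v (i + b) ≠ ext n v (j + b))
    (fun v h => by
      refine ⟨nextOccurrence_of_eqOn hb hij
        (fun k _ _ => ext_flipLetter_of_ne q v (by omega)) h.1, ?_⟩
      rw [ext_flipLetter_of_ne q v (by omega), ext_flipLetter_of_ne q v (by omega)]
      exact h.2)
    (fun v => by
      rw [ext_flipLetter_of_ne q v (k := i + b) (by omega), ← hq, ext_flipLetter_self]
      simp [Bool.eq_not])
  simp only [and_assoc] at hleft hright hE ⊢
  rw [← hleft, ← hright] at hE ⊢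
  have hpos := pos_of_mul_pos_right (pos_of_mul_pos_right hE zero_le_two) zero_le_two
  have hne := (Nat.cast_pos (α := ℝ)).2 hpos |>.ne'
  rw [Nat.cast_mul, Nat.cast_mul, div_eq_div_iff (by positivity) (by norm_num)]
  push_cast
  ring
end

section
/- Let s[i..i+t-1] and s[i..i+t'-1] be right closed repeats of s starting at the same position i, with next occurrences starting at positions q and q' respectively. If t < t', then q < q'. -/
/-- An occurrence of `s[i..j']` is an occurrence of each of its prefixes `s[i..j]`. -/
theorem OccursAt.of_le {α : Type*} {s : ℕ → α} {i j j' k : ℕ} (h : OccursAt s i j' k)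
    (hj : j ≤ j') : OccursAt s i j k :=
  fun d hd => h d (by omega)

/-- Next occurrences are monotone in the right end of the substring. -/
theorem IsNextOcc.le_of_le {α : Type*} {s : ℕ → α} {n i j j' q q' : ℕ}
    (h : IsNextOcc s n i j q) (h' : IsNextOcc s n i j' q') (hj : j ≤ j') : q ≤ q' := by
  obtain ⟨_, _, _, _, _, _, hmin⟩ := h
  obtain ⟨_, _, _, hlt, _, hocc, _⟩ := h'
  by_contra! hq
  exact hmin q' hlt hq (hocc.of_le hj)

/-- If two right closed repeats `s[i..i+t-1]` and `s[i..i+t'-1]` start at the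
same position `i` and have next occurrences starting at `q` and `q'`
respectively, then `t < t'` implies `q < q'`. -/
theorem statement5 {α : Type*} (s : ℕ → α) (n i t t' q q' : ℕ) (ht : 1 ≤ t)
    (h1 : IsRightClosedWith s n i (i + t - 1) q)
    (h2 : IsRightClosedWith s n i (i + t' - 1) q')
    (htt : t < t') : q < q' := by
  obtain ⟨hn, hmax⟩ := h1
  refine lt_of_le_of_ne (hn.le_of_le h2.1 (by omega)) ?_
  rintro rfl
  obtain ⟨⟨_, _, _, _, hfit, hocc, _⟩, _⟩ := h2
  rcases hmax with hend | hne
  · omega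
  · apply hne
    have h := hocc t (by omega)
    rw [show i + t - 1 + 1 = i + t by omega, show q + (i + t - 1 - i) + 1 = q + t by omega]
    exact h.symm
end

section
/- Let s[i..i+t₁-1], s[i..i+t₂-1], s[i..i+t₃-1] be right closed repeats of s starting at the same position i with t₁ < t₂ < t₃, and let their next occurrences start at positions q₁, q₂, q₃ respectively. Then q₃ > q₁ + t₁. -/
/-- Right closed repeats with a common starting position have next occurrences whose positions
strictly increase with the length of the repeat. -/
theorem IsRightClosedWith.lt_of_lt {α : Type*} {s : ℕ → α} {n i j j' q q' : ℕ}
    (h : IsRightClosedWith s n i j q) (h' : IsRightClosedWith s n i j' q') (hj : j < j') :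
    q < q' := by
  obtain ⟨⟨-, hij, -, -, -, -, hmin⟩, hclosed⟩ := h
  obtain ⟨⟨-, -, -, hiq', hqn', hocc', -⟩, -⟩ := h'
  by_contra! hle
  rcases hle.lt_or_eq with hlt | rfl
  · exact hmin q' hiq' hlt fun d hd => hocc' d (by omega)
  · rcases hclosed with hend | hne
    · omega
    · have := hocc' (j - i + 1) (by omega)
      rw [show i + (j - i + 1) = j + 1 by omega] at this
      exact hne this.symm

/-- If three right closed repeats of lengths `t₁ < t₂ < t₃` start at the same
position `i` and have next occurrences starting at `q₁, q₂, q₃` respectively,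
then `q₃ > q₁ + t₁`. -/
theorem statement6 {α : Type*} (s : ℕ → α) (n i t₁ t₂ t₃ q₁ q₂ q₃ : ℕ) (ht : 1 ≤ t₁)
    (h1 : IsRightClosedWith s n i (i + t₁ - 1) q₁)
    (h2 : IsRightClosedWith s n i (i + t₂ - 1) q₂)
    (h3 : IsRightClosedWith s n i (i + t₃ - 1) q₃)
    (h12 : t₁ < t₂) (h23 : t₂ < t₃) : q₁ + t₁ < q₃ := by
  have hq12 : q₁ < q₂ := h1.lt_of_lt h2 (by omega)
  have hq23 : q₂ < q₃ := h2.lt_of_lt h3 (by omega)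
  obtain ⟨⟨-, -, -, -, -, hocc₁, -⟩, hclosed⟩ := h1
  obtain ⟨⟨-, -, -, -, hn₂, hocc₂, -⟩, -⟩ := h2
  obtain ⟨⟨-, -, -, -, -, hocc₃, -⟩, -⟩ := h3
  have hne : s (i + t₁) ≠ s (q₁ + t₁) := by
    rcases hclosed with hend | hne
    · omega
    · rwa [show i + t₁ - 1 + 1 = i + t₁ by omega,
        show q₁ + (i + t₁ - 1 - i) + 1 = q₁ + t₁ by omega] at hne
  by_contra! hle
  obtain ⟨ε, rfl⟩ := Nat.exists_eq_add_of_lt hq12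
  obtain ⟨δ, rfl⟩ := Nat.exists_eq_add_of_lt hq23
  obtain ⟨r, rfl⟩ : ∃ r, t₁ = r + (ε + 1) + (δ + 1) := ⟨t₁ - (ε + 1) - (δ + 1), by omega⟩
  have e₁ := hocc₁ (r + (ε + 1)) (by omega)
  have e₂ := hocc₂ (r + (ε + 1) + (δ + 1)) (by omega)
  have e₃ := hocc₂ r (by omega)
  have e₄ := hocc₃ (r + (ε + 1)) (by omega)
  have e₅ := hocc₃ r (by omega)
  apply hne
  calc s (i + (r + (ε + 1) + (δ + 1)))
      = s (q₁ + ε + 1 + (r + (ε + 1) + (δ + 1))) := e₂.symm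
    _ = s (q₁ + ε + 1 + δ + 1 + (r + (ε + 1))) := by congr 1; omega
    _ = s (i + (r + (ε + 1))) := e₄
    _ = s (q₁ + (r + (ε + 1))) := e₁.symm
    _ = s (q₁ + ε + 1 + r) := by congr 1; omega
    _ = s (i + r) := e₃
    _ = s (q₁ + ε + 1 + δ + 1 + r) := e₅.symm
    _ = s (q₁ + (r + (ε + 1) + (δ + 1))) := by congr 1; omega
end

section
/- Let s be a string of length n and let 1 ≤ i ≤ j ≤ n. If the string s[i..j] occurs in s at some position i' with i' > i and i' + (j - i) ≤ n, then there exists r ≥ 0 with j + r ≤ n such that s[i..j+r] is a right closed repeat of s. -/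
/-- An occurrence to the right of `s[i..j]` that fits in the string yields a next occurrence. -/
theorem exists_isNextOcc {α : Type*} {s : ℕ → α} {n i j i' : ℕ}
    (hi : 1 ≤ i) (hij : i ≤ j) (hj : j ≤ n)
    (hii' : i < i') (hi'n : i' + (j - i) ≤ n) (hocc : OccursAt s i j i') :
    ∃ k, IsNextOcc s n i j k := by
  classical
  have h : ∃ k, i < k ∧ OccursAt s i j k := ⟨i', hii', hocc⟩
  have hle : Nat.find h ≤ i' := Nat.find_min' h ⟨hii', hocc⟩
  exact ⟨Nat.find h, hi, hij, hj, (Nat.find_spec h).1, by omega, (Nat.find_spec h).2,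
    fun k hik hk hkocc => Nat.find_min h hk ⟨hik, hkocc⟩⟩

/-- An occurrence followed by the matching letter is an occurrence of the extended substring. -/
theorem OccursAt.extend_right {α : Type*} {s : ℕ → α} {i j k : ℕ} (hij : i ≤ j)
    (hocc : OccursAt s i j k) (h : s (j + 1) = s (k + (j - i) + 1)) :
    OccursAt s i (j + 1) k := by
  intro d hd
  rcases Nat.lt_or_ge (j - i) d with hlt | hle
  · obtain rfl : d = j - i + 1 := by omega
    rw [← add_assoc, ← h]
    congr 1
    omega
  · exact hocc d hle


/-- Every occurrence `s[i..j]` of a repeat, except the rightmost one, can be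
extended to the right to a right closed repeat `s[i..j+r]`. -/
theorem statement8 {α : Type*} (s : ℕ → α) (n i j i' : ℕ)
    (hi : 1 ≤ i) (hij : i ≤ j) (hj : j ≤ n)
    (hii' : i < i') (hi'n : i' + (j - i) ≤ n) (hocc : OccursAt s i j i') :
    ∃ r : ℕ, j + r ≤ n ∧ IsRightClosedRepeat s n i (j + r) := by
  induction hm : n - j generalizing j i' with
  | zero => omega
  | succ m ih =>
    obtain ⟨k, hk⟩ := exists_isNextOcc hi hij hj hii' hi'n hocc
    by_cases hclosed : k + (j - i) = n ∨ s (j + 1) ≠ s (k + (j - i) + 1)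
    · exact ⟨0, hj, k, hk, hclosed⟩
    · push Not at hclosed
      obtain ⟨hne, heq⟩ := hclosed
      obtain ⟨-, -, -, hik, hkn, hkocc, -⟩ := hk
      obtain ⟨r, hr, hclosed⟩ := ih (j + 1) k (by omega) (by omega) hik (by omega)
        (hkocc.extend_right hij heq) (by omega)
      rw [add_assoc] at hr hclosed
      exact ⟨1 + r, hr, hclosed⟩
end

section
/- If s[i..j] is a closed repeat of the string s, then the string t = s[i..j] is a maximal repeat of s: t occurs in s at least twice, and for every letter a, the number of occurrences of the string t·a in s is strictly smaller than the number of occurrences of t in s, and the number of occurrences of the string a·t in s is strictly smaller than the number of occurrences of t in s. -/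
theorem Nat.card_subtype_lt_of_injective {β γ : Type*} {q : β → Prop} {p : γ → Prop}
    (hp : {x | p x}.Finite) {f : β → γ} (hf : Function.Injective f)
    (hqp : ∀ k, q k → p (f k)) {x : γ} (hx : p x) (hne : ∀ k, q k → f k ≠ x) :
    Nat.card {k // q k} < Nat.card {x // p x} := by
  have hlt : (f '' {k | q k}).ncard < {x | p x}.ncard := by
    refine Set.ncard_lt_ncard ⟨?_, fun hsub => ?_⟩ hp
    · rintro _ ⟨k, hk, rfl⟩
      exact hqp k hk
    · obtain ⟨k, hk, hkx⟩ := hsub hx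
      exact hne k hk hkx
  rwa [Set.ncard_image_of_injective _ hf] at hlt

/-- Every closed repeat `s[i..j]` is, as a string `t = s[i..j]`, a maximal
repeat of `s`: `t` occurs at least twice, and for every letter `a` both `t·a`
and `a·t` have strictly fewer occurrences in `s` than `t`. -/
theorem statement10 {α : Type*} (s : ℕ → α) (n i j : ℕ) (h : IsClosedRepeat s n i j) :
    2 ≤ Nat.card {k : ℕ // 1 ≤ k ∧ k + (j - i) ≤ n ∧ OccursAt s i j k} ∧
    (∀ a : α,
      Nat.card {k : ℕ //
          1 ≤ k ∧ k + (j - i) + 1 ≤ n ∧ OccursAt s i j k ∧ s (k + (j - i) + 1) = a} <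
        Nat.card {k : ℕ // 1 ≤ k ∧ k + (j - i) ≤ n ∧ OccursAt s i j k}) ∧
    (∀ a : α,
      Nat.card {k : ℕ //
          1 ≤ k ∧ k + 1 + (j - i) ≤ n ∧ s k = a ∧ OccursAt s i j (k + 1)} <
        Nat.card {k : ℕ // 1 ≤ k ∧ k + (j - i) ≤ n ∧ OccursAt s i j k}) := by
  obtain ⟨i', ⟨⟨hi, hij, hjn, hii', hi'n, hocc, -⟩, hright⟩, -, hleft⟩ := h
  have hfin : {k : ℕ | 1 ≤ k ∧ k + (j - i) ≤ n ∧ OccursAt s i j k}.Finite :=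
    (Set.finite_Iic n).subset fun k hk => (Nat.le_add_right k _).trans hk.2.1
  have memi : 1 ≤ i ∧ i + (j - i) ≤ n ∧ OccursAt s i j i :=
    ⟨hi, by omega, fun _ _ => rfl⟩
  have memi' : 1 ≤ i' ∧ i' + (j - i) ≤ n ∧ OccursAt s i j i' := ⟨by omega, hi'n, hocc⟩
  refine ⟨?_, fun a => ?_, fun a => ?_⟩
  · exact (Set.one_lt_ncard hfin).2 ⟨i, memi, i', memi', hii'.ne⟩
  · by_cases ha : i' + (j - i) + 1 ≤ n ∧ s (i' + (j - i) + 1) = a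
    · refine Nat.card_subtype_lt_of_injective hfin Function.injective_id
        (fun k hk => ⟨hk.1, by simp only [id]; omega, hk.2.2.1⟩) memi ?_
      rintro k ⟨-, -, -, hk⟩ rfl
      simp only [id] at *
      rcases hright with h | h
      · omega
      · rw [show k + (j - k) + 1 = j + 1 by omega] at hk
        exact h (hk.trans ha.2.symm)
    · refine Nat.card_subtype_lt_of_injective hfin Function.injective_id
        (fun k hk => ⟨hk.1, by simp only [id]; omega, hk.2.2.1⟩) memi' ?_
      rintro k ⟨-, hkn, -, hk⟩ rfl
      exact ha ⟨hkn, hk⟩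
  · by_cases ha : s (i' - 1) = a
    · refine Nat.card_subtype_lt_of_injective hfin (add_left_injective 1)
        (fun k hk => ⟨Nat.le_add_left 1 k, hk.2.1, hk.2.2.2⟩) memi ?_
      rintro k ⟨hk1, -, hk, -⟩ rfl
      rcases hleft with h | h
      · omega
      · exact h (hk.trans ha.symm)
    · refine Nat.card_subtype_lt_of_injective hfin (add_left_injective 1)
        (fun k hk => ⟨Nat.le_add_left 1 k, hk.2.1, hk.2.2.2⟩) memi' ?_
      rintro k ⟨-, -, hk, -⟩ rfl
      exact ha hk
end

section
/- Let t be a non-empty string that occurs in a string s at least twice and such that for every letter a, the number of occurrences of the string t·a in s is strictly smaller than the number of occurrences of t in s. Then some occurrence of t in s is a right closed repeat: there exists a position i such that s[i..i+|t|-1] = t and s[i..i+|t|-1] is a right closed repeat of s. -/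
/-- The string `t[1..m]` occurs in the string `s[1..n]` at position `k`. -/
def TOccursAt {α : Type*} (t : ℕ → α) (m : ℕ) (s : ℕ → α) (n k : ℕ) : Prop :=
  1 ≤ k ∧ k + m - 1 ≤ n ∧ ∀ d : ℕ, d < m → s (k + d) = t (1 + d)

/-- If no occurrence of `t` is a right closed repeat, any two occurrences of `t` are followed
by the same letter. -/
theorem TOccursAt.eq_next_letter {α : Type*} {s t : ℕ → α} {n m : ℕ} (hm : 1 ≤ m)
    (hno : ∀ i, TOccursAt t m s n i → ¬ IsRightClosedRepeat s n i (i + m - 1)) {i k : ℕ}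
    (hi : TOccursAt t m s n i) (hk : TOccursAt t m s n k) (hik : i < k) :
    k + m ≤ n ∧ s (k + m) = s (i + m) := by
  induction hd : k - i using Nat.strong_induction_on generalizing i k with
  | _ d ih =>
    subst hd
    by_cases hex : ∃ j, i < j ∧ j < k ∧ TOccursAt t m s n j
    · obtain ⟨j, hij, hjk, hj⟩ := hex
      have h₁ := ih (j - i) (by omega) hi hj hij rfl
      have h₂ := ih (k - j) (by omega) hj hk hjk rfl
      exact ⟨h₂.1, h₂.2.trans h₁.2⟩
    · have hlen : i + m - 1 - i = m - 1 := by omega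
      obtain ⟨hi1, hin, hit⟩ := hi
      obtain ⟨hk1, hkn, hkt⟩ := hk
      have hnext : IsNextOcc s n i (i + m - 1) k := by
        refine ⟨hi1, by omega, hin, hik, by omega, fun d hd => ?_, fun j hij hjk hj => ?_⟩
        · rw [hkt d (by omega), hit d (by omega)]
        · refine hex ⟨j, hij, hjk, by omega, by omega, fun d hd => ?_⟩
          rw [hj d (by omega), hit d hd]
      by_contra hcon
      refine hno i ⟨hi1, hin, hit⟩ ⟨k, hnext, ?_⟩
      rw [hlen, Nat.sub_add_cancel (by omega), show k + (m - 1) + 1 = k + m by omega]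
      by_cases hkm : k + m ≤ n
      · exact Or.inr fun h => hcon ⟨hkm, h.symm⟩
      · left; omega

/-- If a non-empty string `t` occurs in `s` at least twice and, for every letter
`a`, the string `t·a` has strictly fewer occurrences in `s` than `t`, then some
occurrence of `t` in `s` is a right closed repeat. -/
theorem statement11 {α : Type*} (s t : ℕ → α) (n m : ℕ) (hm : 1 ≤ m)
    (hocc : 2 ≤ Nat.card {k : ℕ // TOccursAt t m s n k})
    (hmax : ∀ a : α,
      Nat.card {k : ℕ // TOccursAt t m s n k ∧ k + m ≤ n ∧ s (k + m) = a} <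
        Nat.card {k : ℕ // TOccursAt t m s n k}) :
    ∃ i : ℕ, TOccursAt t m s n i ∧ IsRightClosedRepeat s n i (i + m - 1) := by
  by_contra! hno
  have : Finite {k : ℕ // TOccursAt t m s n k} := Nat.finite_of_card_ne_zero (by omega)
  have : Nontrivial {k : ℕ // TOccursAt t m s n k} :=
    Finite.one_lt_card_iff_nontrivial.mp hocc
  obtain ⟨⟨x, hx⟩, ⟨y, hy⟩, hxy⟩ := exists_pair_lt {k : ℕ // TOccursAt t m s n k}
  replace hxy : x < y := hxy
  refine (hmax (s (x + m))).ne (Nat.card_congr (Equiv.subtypeEquivRight fun k => ?_))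
  refine ⟨And.left, fun hk => ⟨hk, ?_⟩⟩
  rcases lt_trichotomy k x with h | rfl | h
  · have := hx.2.1
    exact ⟨by omega, (hk.eq_next_letter hm hno hx h).2.symm⟩
  · have := hy.2.1
    exact ⟨by omega, rfl⟩
  · exact hx.eq_next_letter hm hno hk h
end

section
/- Let s[i..j] be a run of the string s with minimal period p. Then s[i..j-p] is a closed repeat of s and its next occurrence is s[i+p..j]. -/
/-- `p` is a period of the substring `s[i..j]`: `s[k+p] = s[k]` for all `k` with
`i ≤ k` and `k + p ≤ j`. -/
def HasPeriod {α : Type*} (s : ℕ → α) (i j p : ℕ) : Prop :=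
  ∀ k, i ≤ k → k + p ≤ j → s (k + p) = s k

/-- `s[i..j]` is a run (maximal repetition) of the string `s` of length `n`
with minimal period `p`. -/
def IsRun {α : Type*} (s : ℕ → α) (n i j p : ℕ) : Prop :=
  1 ≤ i ∧ i ≤ j ∧ j ≤ n ∧ 0 < p ∧ HasPeriod s i j p ∧
    (∀ p', 0 < p' → p' < p → ¬ HasPeriod s i j p') ∧
    2 * p ≤ j - i + 1 ∧
    (1 < i → ¬ HasPeriod s (i - 1) j p) ∧
    (j < n → ¬ HasPeriod s i (j + 1) p)

/-- In a string of length at least `2 * p` with period `p`, an occurrence of its prefix `s[i..j-p]`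
at position `i + q` makes `q` a period of the whole string. -/
theorem HasPeriod.of_occursAt {α : Type*} {s : ℕ → α} {i j p q : ℕ} (hp : HasPeriod s i j p)
    (hlen : i + 2 * p ≤ j + 1) (hocc : OccursAt s i (j - p) (i + q)) :
    HasPeriod s i j q := by
  have shift : ∀ x, i ≤ x → x + p ≤ j → s (x + q) = s x := by
    intro x hx hxj
    have h := hocc (x - i) (by omega)
    rwa [show i + q + (x - i) = x + q by omega, show i + (x - i) = x by omega] at h
  intro x hx hxj
  by_cases hxp : x + p ≤ j
  · exact shift x hx hxp
  · obtain ⟨y, rfl⟩ : ∃ y, x = y + p := ⟨x - p, by omega⟩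
    rw [show y + p + q = y + q + p by omega, hp (y + q) (by omega) (by omega),
      shift y (by omega) (by omega), hp y (by omega) (by omega)]

/-- If `s[i..j]` is a run with minimal period `p`, then `s[i..j-p]` is a closed
repeat of `s` whose next occurrence is `s[i+p..j]`. -/
theorem statement12 {α : Type*} (s : ℕ → α) (n i j p : ℕ) (h : IsRun s n i j p) :
    IsClosedWith s n i (j - p) (i + p) := by
  obtain ⟨hi, hij, hjn, hp0, hp, hmin, hlen, hleft, hright⟩ := h
  have hnext : IsNextOcc s n i (j - p) (i + p) := by
    refine ⟨hi, by omega, by omega, by omega, by omega, fun d hd => ?_, fun k hik hk hocc => ?_⟩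
    · rw [show i + p + d = i + d + p by omega]
      exact hp (i + d) (by omega) (by omega)
    · obtain ⟨q, rfl⟩ : ∃ q, k = i + q := ⟨k - i, by omega⟩
      exact hmin q (by omega) (by omega) (hp.of_occursAt (by omega) hocc)
  refine ⟨⟨hnext, ?_⟩, hnext, ?_⟩
  · by_cases hj : j = n
    · left
      omega
    · refine Or.inr fun heq => hright (by omega) fun k hk hkj => ?_
      by_cases hkp : k + p ≤ j
      · exact hp k hk hkp
      · rw [show i + p + (j - p - i) + 1 = k + p by omega, show j - p + 1 = k by omega] at heq
        exact heq.symm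
  · by_cases hi1 : i = 1
    · exact Or.inl hi1
    · refine Or.inr fun heq => hleft (by omega) fun k hk hkj => ?_
      by_cases hki : i ≤ k
      · exact hp k hki hkj
      · rw [show i + p - 1 = k + p by omega, show i - 1 = k by omega] at heq
        exact heq.symm
end

section
/- If s[i..j] is a closed repeat of the string s and s[i'..j'] is its next occurrence, then s[i..j'] is a maximal closed substring of s, and s[i..j] is a non-empty proper border of s[i..j'] that occurs in s[i..j'] only as a prefix and as a suffix and is the longest such border. -/
/-- `s[p..q]` (of length at least 2) is a closed substring: it has a non-empty
proper border (`s[p..p+b]` with `b < q - p`) occurring in `s[p..q]` only as a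
prefix and as a suffix. -/
def IsClosedSubstr {α : Type*} (s : ℕ → α) (p q : ℕ) : Prop :=
  p < q ∧ ∃ b : ℕ, b < q - p ∧ OccursAt s p (p + b) (q - b) ∧
    ∀ k, p ≤ k → k + b ≤ q → OccursAt s p (p + b) k → k = p ∨ k = q - b

/-- `s[p..q]` is a maximal closed substring of the string `s` of length `n`. -/
def IsMCS {α : Type*} (s : ℕ → α) (n p q : ℕ) : Prop :=
  1 ≤ p ∧ q ≤ n ∧ IsClosedSubstr s p q ∧
    (1 < p → ¬ IsClosedSubstr s (p - 1) q) ∧ (q < n → ¬ IsClosedSubstr s p (q + 1))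

/-- A shorter prefix occurs wherever a longer one does. -/
theorem OccursAt.mono {α : Type*} {s : ℕ → α} {i j j₂ k : ℕ} (h : OccursAt s i j k)
    (hj : j₂ ≤ j) : OccursAt s i j₂ k :=
  fun d hd => h d (by omega)

/-- A non-empty proper border of `s[i..j']`, where `s[i'..j']` is the next occurrence of `s[i..j]`,
is at most as long as `s[i..j]`. -/
theorem IsNextOcc.not_occursAt_of_lt {α : Type*} {s : ℕ → α} {n i j i' b : ℕ}
    (h : IsNextOcc s n i j i') (hb : j - i < b) (hb' : b < i' + (j - i) - i) :
    ¬ OccursAt s i (i + b) (i' + (j - i) - b) := by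
  obtain ⟨_, hij, -, hlt, -, -, hno⟩ := h
  exact fun ho => hno _ (by omega) (by omega) (ho.mono (by omega))

/-- Inside `s[i..j']`, where `s[i'..j']` is the next occurrence of `s[i..j]`, the substring
`s[i..j]` occurs only as a prefix and as a suffix. -/
theorem IsNextOcc.eq_or_eq_of_occursAt {α : Type*} {s : ℕ → α} {n i j i' k : ℕ}
    (h : IsNextOcc s n i j i') (hk : i ≤ k) (hk' : k ≤ i') (ho : OccursAt s i j k) :
    k = i ∨ k = i' := by
  obtain ⟨-, -, -, -, -, -, hno⟩ := h
  by_contra! hne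
  exact hno k (by omega) (by omega) ho

/-- A substring and its next occurrence span a closed substring. -/
theorem IsNextOcc.isClosedSubstr {α : Type*} {s : ℕ → α} {n i j i' : ℕ}
    (h : IsNextOcc s n i j i') : IsClosedSubstr s i (i' + (j - i)) := by
  have ⟨_, hij, _, hlt, _, hocc, _⟩ := h
  have hj : i + (j - i) = j := by omega
  have hi' : i' + (j - i) - (j - i) = i' := by omega
  refine ⟨by omega, j - i, by omega, ?_, ?_⟩
  · rwa [hj, hi']
  · rw [hj, hi']
    exact fun k hk hk' ho => h.eq_or_eq_of_occursAt hk (by omega) ho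

/-- A left closed repeat and its next occurrence span a substring that is not closed when extended
to the left. -/
theorem IsLeftClosedWith.not_isClosedSubstr {α : Type*} {s : ℕ → α} {n i j i' : ℕ}
    (h : IsLeftClosedWith s n i j i') (hi : 1 < i) :
    ¬ IsClosedSubstr s (i - 1) (i' + (j - i)) := by
  obtain ⟨hnext, hleft⟩ := h
  rintro ⟨-, b, hb, ho, hu⟩
  have ⟨_, hij, _, hlt, _, hocc, _⟩ := hnext
  rcases lt_trichotomy b (j - i + 1) with hbl | rfl | hbl
  · have := hu (j - b) (by omega) (by omega) fun d hd => by
      rw [← ho d hd]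
      have := hocc (j - b - i + d) (by omega)
      rw [show i' + (j - b - i + d) = i' + (j - i) - b + d by omega,
        show i + (j - b - i + d) = j - b + d by omega] at this
      exact this.symm
    omega
  · have := ho 0 (by omega)
    rw [show i' + (j - i) - (j - i + 1) + 0 = i' - 1 by omega, add_zero] at this
    exact hleft.elim (by omega) fun hne => hne this.symm
  · refine hnext.not_occursAt_of_lt (b := b - 1) (by omega) (by omega) fun d hd => ?_
    have := ho (d + 1) (by omega)
    rwa [show i' + (j - i) - b + (d + 1) = i' + (j - i) - (b - 1) + d by omega,
      show i - 1 + (d + 1) = i + d by omega] at this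

/-- A right closed repeat and its next occurrence span a substring that is not closed when extended
to the right. -/
theorem IsRightClosedWith.not_isClosedSubstr {α : Type*} {s : ℕ → α} {n i j i' : ℕ}
    (h : IsRightClosedWith s n i j i') (hn : i' + (j - i) < n) :
    ¬ IsClosedSubstr s i (i' + (j - i) + 1) := by
  obtain ⟨hnext, hright⟩ := h
  rintro ⟨-, b, hb, ho, hu⟩
  have ⟨_, hij, _, hlt, _, hocc, _⟩ := hnext
  rcases lt_trichotomy b (j - i + 1) with hbl | rfl | hbl
  · have := hu i' (by omega) (by omega) (hocc.mono (by omega))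
    omega
  · have := ho (j - i + 1) (by omega)
    rw [show i' + (j - i) + 1 - (j - i + 1) + (j - i + 1) = i' + (j - i) + 1 by omega,
      show i + (j - i + 1) = j + 1 by omega] at this
    exact hright.elim (by omega) fun hne => hne this.symm
  · refine hnext.not_occursAt_of_lt (b := b - 1) (by omega) (by omega) ?_
    rw [show i' + (j - i) - (b - 1) = i' + (j - i) + 1 - b by omega]
    exact ho.mono (by omega)

/-- If `s[i..j]` is a closed repeat with next occurrence `s[i'..j']`
(`j' = i' + (j - i)`), then `s[i..j']` is a maximal closed substring and
`s[i..j]` is a non-empty proper border of `s[i..j']` occurring in it only as a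
prefix and as a suffix, and it is the longest such border. -/
theorem statement13 {α : Type*} (s : ℕ → α) (n i j i' : ℕ)
    (h : IsClosedWith s n i j i') :
    IsMCS s n i (i' + (j - i)) ∧
    j - i < i' + (j - i) - i ∧
    OccursAt s i j i' ∧
    (∀ k, i ≤ k → k + (j - i) ≤ i' + (j - i) → OccursAt s i j k → k = i ∨ k = i') ∧
    (∀ b', j - i < b' → b' < i' + (j - i) - i →
      ¬ (OccursAt s i (i + b') (i' + (j - i) - b') ∧
         ∀ k, i ≤ k → k + b' ≤ i' + (j - i) → OccursAt s i (i + b') k →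
           k = i ∨ k = i' + (j - i) - b')) := by
  obtain ⟨hr, hl⟩ := h
  have hnext := hr.1
  have ⟨hi, hij, _, hlt, hn, hocc, _⟩ := hnext
  exact ⟨⟨hi, hn, hnext.isClosedSubstr, hl.not_isClosedSubstr, hr.not_isClosedSubstr⟩,
    by omega, hocc, fun k hk hk' => hnext.eq_or_eq_of_occursAt hk (by omega),
    fun b hb hb' ho => hnext.not_occursAt_of_lt hb hb' ho.1⟩
end

section
/- Let s[p..q] be a maximal closed substring of the string s and let s[p..p+b] (with 0 ≤ b < q - p) be the longest non-empty proper border of s[p..q] that occurs in s[p..q] only as a prefix and as a suffix. Then s[p..p+b] is a closed repeat of s and its next occurrence is s[q-b..q]. -/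
/-- If `s[p..q]` is a maximal closed substring and `s[p..p+b]` is its longest
non-empty proper border occurring in `s[p..q]` only as a prefix and as a
suffix, then `s[p..p+b]` is a closed repeat of `s` with next occurrence
`s[q-b..q]`. -/
theorem statement14 {α : Type*} (s : ℕ → α) (n p q b : ℕ)
    (hmcs : IsMCS s n p q) (hb : b < q - p)
    (hborder : OccursAt s p (p + b) (q - b))
    (honly : ∀ k, p ≤ k → k + b ≤ q → OccursAt s p (p + b) k → k = p ∨ k = q - b)
    (hlongest : ∀ b', b < b' → b' < q - p →
      ¬ (OccursAt s p (p + b') (q - b') ∧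
         ∀ k, p ≤ k → k + b' ≤ q → OccursAt s p (p + b') k → k = p ∨ k = q - b')) :
    IsClosedWith s n p (p + b) (q - b) := by
  obtain ⟨hp, hq, -, hleft, hright⟩ := hmcs
  have hnext : IsNextOcc s n p (p + b) (q - b) := by
    refine ⟨hp, by omega, by omega, by omega, by omega, hborder, fun k hk hk' hocc => ?_⟩
    rcases honly k (by omega) (by omega) hocc with h | h <;> omega
  refine ⟨⟨hnext, ?_⟩, hnext, ?_⟩
  · by_contra! h
    obtain ⟨hne, heq⟩ := h
    refine hright (by omega) ⟨by omega, b + 1, by omega, fun d hd => ?_, fun k hk hkq hocc => ?_⟩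
    · rw [show q + 1 - (b + 1) = q - b by omega]
      rcases Nat.lt_or_ge b d with hbd | hbd
      · obtain rfl : d = b + 1 := by omega
        rw [show p + b - p = b by omega] at heq
        exact heq.symm
      · exact hborder d (by omega)
    · have := honly k hk (by omega) fun d hd => hocc d (by omega)
      omega
  · by_contra! h
    obtain ⟨hne, heq⟩ := h
    refine hleft (by omega) ⟨by omega, b + 1, by omega, fun d hd => ?_, fun k hk hkq hocc => ?_⟩
    · rcases d with _ | d
      · simpa only [Nat.add_zero, Nat.sub_sub] using heq.symm
      · rw [show q - (b + 1) + (d + 1) = q - b + d by omega,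
          show p - 1 + (d + 1) = p + d by omega]
        exact hborder d (by omega)
    · have := honly (k + 1) (by omega) (by omega) fun d hd => by
        have h := hocc (d + 1) (by omega)
        rwa [show k + (d + 1) = k + 1 + d by omega,
          show p - 1 + (d + 1) = p + d by omega] at h
      omega
end

section
/- Let s be a string of length n, let 1 ≤ i and i + ℓ - 1 ≤ n with ℓ ≥ 2, and let p be the minimal period of the substring s[i..i+ℓ-1]. If 2p ≤ ℓ, then there exists an integer t with t ≥ ℓ - p such that s[i..i+t-1] is a right closed repeat of s whose next occurrence is s[i+p..i+p+t-1]. -/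
/-- If the prefix of length `ℓ - p` of `s[i..i+ℓ-1]` occurs at `i + q`, and `s[i..i+ℓ-1]` has
a period `p` with `2p ≤ ℓ`, then `q` is a period of `s[i..i+ℓ-1]`. -/
theorem HasPeriod.of_prefix_occurrence {α : Type*} {s : ℕ → α} {i ℓ p q : ℕ} (hp : 0 < p)
    (h2p : 2 * p ≤ ℓ) (hper : HasPeriod s i (i + ℓ - 1) p)
    (hocc : ∀ d, d < ℓ - p → s (i + q + d) = s (i + d)) :
    HasPeriod s i (i + ℓ - 1) q := by
  intro k hk hkq
  obtain ⟨d, rfl⟩ := Nat.exists_eq_add_of_le hk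
  by_cases hd : d < ℓ - p
  · rw [show i + d + q = i + q + d by omega, hocc d hd]
  · obtain ⟨e, rfl⟩ := Nat.exists_eq_add_of_le (show p ≤ d by omega)
    calc s (i + (p + e) + q) = s (i + q + e + p) := by congr 1; omega
      _ = s (i + q + e) := hper _ (by omega) (by omega)
      _ = s (i + e) := hocc e (by omega)
      _ = s (i + e + p) := (hper _ (by omega) (by omega)).symm
      _ = s (i + (p + e)) := by congr 1; omega

/-- If `p` is the minimal period of `s[i..i+ℓ-1]` and `2p ≤ ℓ`, then there is a
right closed repeat `s[i..i+t-1]` with `t ≥ ℓ - p` whose next occurrence is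
`s[i+p..i+p+t-1]`. -/
theorem statement18 {α : Type*} (s : ℕ → α) (n i ℓ p : ℕ)
    (hi : 1 ≤ i) (hℓ : 2 ≤ ℓ) (hn : i + ℓ - 1 ≤ n)
    (hp : 0 < p) (hper : HasPeriod s i (i + ℓ - 1) p)
    (hmin : ∀ p', 0 < p' → p' < p → ¬ HasPeriod s i (i + ℓ - 1) p')
    (h2p : 2 * p ≤ ℓ) :
    ∃ t : ℕ, ℓ - p ≤ t ∧ IsRightClosedWith s n i (i + t - 1) (i + p) := by
  classical
  let P : ℕ → Prop := fun t => ∀ d, d < t → s (i + p + d) = s (i + d)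
  have hP : P (ℓ - p) := fun d hd => by
    rw [Nat.add_right_comm]
    exact hper (i + d) (by omega) (by omega)
  obtain ⟨t, ht, hle, hPt, hmax⟩ : ∃ t, ℓ - p ≤ t ∧ t ≤ n + 1 - i - p ∧ P t ∧
      (t < n + 1 - i - p → ¬ P (t + 1)) :=
    ⟨Nat.findGreatest P (n + 1 - i - p), Nat.le_findGreatest (by omega) hP,
      Nat.findGreatest_le _, Nat.findGreatest_spec (m := ℓ - p) (by omega) hP,
      fun h => Nat.findGreatest_is_greatest (Nat.lt_succ_self _) h⟩
  refine ⟨t, ht, ⟨hi, by omega, by omega, by omega, by omega,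
    fun d hd => hPt d (by omega), fun k hik hkp hocc => ?_⟩, ?_⟩
  · obtain ⟨q, rfl⟩ := Nat.exists_eq_add_of_le hik.le
    exact hmin q (by omega) (by omega)
      (hper.of_prefix_occurrence hp h2p fun d hd => hocc d (by omega))
  · by_cases hend : t < n + 1 - i - p
    · right
      intro heq
      refine hmax hend fun d hd => ?_
      rcases Nat.lt_succ_iff_lt_or_eq.mp hd with h | rfl
      · exact hPt d h
      · rw [show i + p + d = i + p + (i + d - 1 - i) + 1 by omega, ← heq]
        congr 1; omega
    · left; omega
end

section
/- Let s[q₁..q₁+t₁-1] and s[q₂..q₂+t₂-1] be right closed repeats of the string s whose next occurrences start at the same position p (i.e., the next occurrence of s[q₁..q₁+t₁-1] is s[p..p+t₁-1] and the next occurrence of s[q₂..q₂+t₂-1] is s[p..p+t₂-1]). If t₁ < t₂, then q₁ > q₂. -/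
/-- If two right closed repeats `s[q₁..q₁+t₁-1]` and `s[q₂..q₂+t₂-1]` have next
occurrences starting at the same position `p`, then `t₁ < t₂` implies
`q₁ > q₂`. -/
theorem statement19 {α : Type*} (s : ℕ → α) (n p q₁ q₂ t₁ t₂ : ℕ) (ht : 1 ≤ t₁)
    (h1 : IsRightClosedWith s n q₁ (q₁ + t₁ - 1) p)
    (h2 : IsRightClosedWith s n q₂ (q₂ + t₂ - 1) p)
    (htt : t₁ < t₂) : q₂ < q₁ := by
  obtain ⟨⟨_, _, _, _, _, hocc₁, hno₁⟩, hclosed⟩ := h1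
  obtain ⟨⟨_, _, _, hlt₂, hfit₂, hocc₂, _⟩, _⟩ := h2
  by_contra! hle
  rcases hle.eq_or_lt with rfl | hlt
  · rcases hclosed with hend | hne
    · omega
    · apply hne
      have h := hocc₂ t₁ (by omega)
      rw [show q₁ + t₁ - 1 + 1 = q₁ + t₁ by omega,
        show p + (q₁ + t₁ - 1 - q₁) + 1 = p + t₁ by omega]
      exact h.symm
  · refine hno₁ q₂ hlt hlt₂ fun d hd => ?_
    rw [← hocc₂ d (by omega), hocc₁ d hd]
end
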